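/- For every n and every x ∈ 2^n: x, K(x), k_x → Ω^{n,k_x}, i.e. from x together with K(x) and the m-depth k_x one can compute, by a fixed O(1)-length program, the first k_x bits of the binary expansion of Ω^n. -/

import Mathlib

open scoped BigOperators
open scoped Classical

/-- The standard bijection between natural numbers and finite binary strings
(`ε ↦ 0`, `0 ↦ 1`, `1 ↦ 2`, `00 ↦ 3`, ...), inverse direction. -/
def strOfNat (n : ℕ) : List Bool := (n + 1).bits.dropLast

/-- Base-2 tetration: `1, 2, 2^2, 2^(2^2), ...`. -/
def tetr : ℕ → ℕ
  | 0 => 1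
  | k + 1 => 2 ^ tetr k

/-- The super-logarithm, the inverse of base-2 tetration. -/
noncomputable def slog (x : ℕ) : ℕ := sSup {k | tetr k ≤ x}

noncomputable section

/-- A machine given by a computable, monotone (in time) stepwise evaluation function
`step t p y n` : time `t`, program `p`, condition `y`, length parameter `n`
(the length parameter is always available). -/
structure Machine where
  step : ℕ → List Bool → ℕ → ℕ → Option ℕ
  computable_step :
    Computable fun q : (ℕ × List Bool) × ℕ × ℕ => step q.1.1 q.1.2 q.2.1 q.2.2
  mono : ∀ {t t' : ℕ} {p : List Bool} {y n v : ℕ}, t ≤ t' →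
      step t p y n = some v → step t' p y n = some v

namespace Machine

variable (M : Machine)

/-- `M(p|y,n) ↓ = v`. -/
def Outputs (p : List Bool) (y n v : ℕ) : Prop := ∃ t, M.step t p y n = some v

/-- `M(p|y,n) ↓`. -/
def HaltsOn (p : List Bool) (y n : ℕ) : Prop := ∃ v, M.Outputs p y n v

/-- the domain of `M` is prefix-free (for every condition). -/
def PrefixFree : Prop :=
  ∀ {p q : List Bool} {y n : ℕ}, M.HaltsOn p y n → M.HaltsOn q y n → p <+: q → p = q

/-- Kolmogorov complexity with respect to `M` (prefix-free complexity `K` when `M` is an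
optimal prefix-free interpreter, plain complexity `C` when `M` is an optimal plain machine). -/
def C (x y n : ℕ) : ℕ := sInf {l | ∃ p : List Bool, p.length = l ∧ M.Outputs p y n x}

/-- Time-bounded Kolmogorov complexity (`⊤` if no program produces `x` within time `t`). -/
def Ct (t x y n : ℕ) : ℕ∞ :=
  sInf {l : ℕ∞ | ∃ p : List Bool, (p.length : ℕ∞) = l ∧ M.step t p y n = some x}

/-- every value has a program, for every condition. -/
def Total : Prop := ∀ x y n, ∃ p : List Bool, M.Outputs p y n x

/-- `M` is an optimal universal prefix-free interpreter. -/
def POptimal : Prop := M.PrefixFree ∧ M.Total ∧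
  ∀ N : Machine, N.PrefixFree → ∃ c, ∀ (p : List Bool) (y n v : ℕ),
    N.Outputs p y n v → M.C v y n ≤ p.length + c

/-- `M` is an optimal universal plain machine. -/
def Optimal : Prop := M.Total ∧
  ∀ N : Machine, ∃ c, ∀ (p : List Bool) (y n v : ℕ),
    N.Outputs p y n v → M.C v y n ≤ p.length + c

/-- `p` is a shortest program for `x` (given `y`, `n`) on `M`. -/
def ShortestProg (p : List Bool) (x y n : ℕ) : Prop :=
  M.Outputs p y n x ∧ p.length = M.C x y n

/-- `u → v`: some program of length at most `c` computes `v` from `u` (and `n`). -/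
def Computes (c u n v : ℕ) : Prop := ∃ q : List Bool, q.length ≤ c ∧ M.Outputs q u n v

/-- `Ω^n_t`. -/
def OmegaT (n t : ℕ) : ℝ :=
  ∑' p : List Bool,
    if ∃ v, v < 2 ^ n ∧ M.step t p 0 n = some v then (2 : ℝ) ^ (-(p.length : ℤ)) else 0

/-- `Ω^n`. -/
def Omega (n : ℕ) : ℝ :=
  ∑' p : List Bool,
    if ∃ v, v < 2 ^ n ∧ M.Outputs p 0 n v then (2 : ℝ) ^ (-(p.length : ℤ)) else 0

/-- `t_k = min { t : Ω^n − Ω^n_t ≤ 2^{−k} }`. -/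
def tk (n k : ℕ) : ℕ := sInf {t | M.Omega n - M.OmegaT n t ≤ (2 : ℝ) ^ (-(k : ℤ))}

/-- the computational `m`-depth `k_x` of `x ∈ 2^n`, with additive constant `d`:
`k_x = min { k : K_{t_k}(x) ≤ K(x) + d }`. -/
def mdepth (d n x : ℕ) : ℕ :=
  sInf {k | ∃ p : List Bool, p.length ≤ M.C x 0 n + d ∧ M.step (M.tk n k) p 0 n = some x}

/-- `Ω^{n,j}`: the first `j` bits of the binary expansion of `Ω^n`, as a natural number. -/
def OmegaBits (n j : ℕ) : ℕ := ⌊M.Omega n * 2 ^ j⌋₊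

/-- `H^{n,j}`: the first `j` bits of the Halting sequence `H^n` of `M`, as a natural number. -/
def Hbits (n j : ℕ) : ℕ :=
  ∑ i ∈ Finset.range j, if M.HaltsOn (strOfNat i) 0 n then 2 ^ i else 0

/-- The Busy Beaver function of `M`: `BB(k) = max { M(p) : p ∈ 2^k, M(p)↓ }`. -/
def BB (n k : ℕ) : ℕ := sSup {v | ∃ p : List Bool, p.length = k ∧ M.Outputs p 0 n v}

end Machine

/-- `p` is a program on `M` computing the rational-valued function `P`. -/
def ProgForProb (M : Machine) (p : List Bool) (P : ℕ → ℚ) (n : ℕ) : Prop :=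
  ∀ y, M.Outputs p y n (Encodable.encode (P y))

/-- Complexity of the function `P` with respect to `M`. -/
noncomputable def KProb (M : Machine) (n : ℕ) (P : ℕ → ℚ) : ℕ :=
  sInf {l | ∃ p : List Bool, p.length = l ∧ ProgForProb M p P n}

/-- a (length conditional) semimeasure on `2^n`. -/
def IsSemimeasure (n : ℕ) (P : ℕ → ℚ) : Prop :=
  (∀ y, 0 ≤ P y) ∧ ∑ y ∈ Finset.range (2 ^ n), P y ≤ 1

/-- `p` is a program on `M` computing the partial function `F` (on binary strings). -/
def ProgForFun (M : Machine) (p : List Bool) (F : List Bool → Option ℕ) (n : ℕ) : Prop :=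
  ∀ d v, F d = some v ↔ M.Outputs p (Encodable.encode d) n v

/-- `F` has prefix-free domain. -/
def PrefixFreeFun (F : List Bool → Option ℕ) : Prop :=
  ∀ d d', (F d).isSome → (F d').isSome → d <+: d' → d = d'

/-- Complexity of the partial function `F` with respect to `M`. -/
noncomputable def KFun (M : Machine) (n : ℕ) (F : List Bool → Option ℕ) : ℕ :=
  sInf {l | ∃ p : List Bool, p.length = l ∧ ProgForFun M p F n}

/-- sufficient set statistic: `x ∈ S` and `K(S) + log|S| = K(x) ± c`. -/
def SufficientSet (Φ : Machine) (c n x : ℕ) (S : Finset ℕ) : Prop :=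
  x ∈ S ∧ S ⊆ Finset.range (2 ^ n) ∧
    Nat.dist (Φ.C (Encodable.encode S) 0 n + Nat.log 2 S.card) (Φ.C x 0 n) ≤ c

/-- sufficient probabilistic statistic: `P` computable semimeasure, `K(P) − log P(x) = K(x) ± c`. -/
def SufficientProb (Φ : Machine) (c n x : ℕ) (P : ℕ → ℚ) : Prop :=
  IsSemimeasure n P ∧ (∃ p, ProgForProb Φ p P n) ∧
    |(KProb Φ n P : ℝ) - Real.logb 2 (P x) - (Φ.C x 0 n : ℝ)| ≤ c

/-- sufficient function statistic: `F` computable prefix-free,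
`K(F) + l(d) = K(x) ± c` for some `d` with `F(d) = x`. -/
def SufficientFun (Φ : Machine) (c n x : ℕ) (F : List Bool → Option ℕ) : Prop :=
  PrefixFreeFun F ∧ (∃ p, ProgForFun Φ p F n) ∧
    ∃ d, F d = some x ∧ Nat.dist (KFun Φ n F + d.length) (Φ.C x 0 n) ≤ c

/-- minimal sufficient set statistic (within the constant `c`). -/
def MinimalSufficientSet (Φ : Machine) (c n x : ℕ) (S : Finset ℕ) : Prop :=
  SufficientSet Φ c n x S ∧ ∀ S' : Finset ℕ, SufficientSet Φ c n x S' →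
    Φ.C (Encodable.encode S) 0 n ≤ Φ.C (Encodable.encode S') 0 n + c

/-- `l^S_x`: the complexity of a minimal sufficient set statistic. -/
noncomputable def lSet (Φ : Machine) (c n x : ℕ) : ℕ :=
  sInf {l | ∃ S : Finset ℕ, SufficientSet Φ c n x S ∧ Φ.C (Encodable.encode S) 0 n = l}

/-- `l^P_x`: the complexity of a minimal sufficient probabilistic statistic. -/
noncomputable def lProb (Φ : Machine) (c n x : ℕ) : ℕ :=
  sInf {l | ∃ P : ℕ → ℚ, SufficientProb Φ c n x P ∧ KProb Φ n P = l}

/-- `l^F_x`: the complexity of a minimal sufficient function statistic. -/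
noncomputable def lFun (Φ : Machine) (c n x : ℕ) : ℕ :=
  sInf {l | ∃ F : List Bool → Option ℕ, SufficientFun Φ c n x F ∧ KFun Φ n F = l}

/-- weak sufficient set statistic: `C(S) + log|S| = K(x|C(S)) ± c`
(`Φ` the prefix-free interpreter, `Ψ` the plain machine). -/
def WeakSufficientSet (Φ Ψ : Machine) (c n x : ℕ) (S : Finset ℕ) : Prop :=
  x ∈ S ∧ S ⊆ Finset.range (2 ^ n) ∧
    Nat.dist (Ψ.C (Encodable.encode S) 0 n + Nat.log 2 S.card)
      (Φ.C x (Ψ.C (Encodable.encode S) 0 n) n) ≤ c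

/-- weak sufficient probabilistic statistic: `C(P) − log P(x) = K(x|C(P)) ± c`. -/
def WeakSufficientProb (Φ Ψ : Machine) (c n x : ℕ) (P : ℕ → ℚ) : Prop :=
  IsSemimeasure n P ∧ (∃ p, ProgForProb Ψ p P n) ∧
    |(KProb Ψ n P : ℝ) - Real.logb 2 (P x) - (Φ.C x (KProb Ψ n P) n : ℝ)| ≤ c

/-- weak sufficient function statistic: `C(F) + l(d) = K(x|C(F)) ± c` for some `d`, `F(d) = x`. -/
def WeakSufficientFun (Φ Ψ : Machine) (c n x : ℕ) (F : List Bool → Option ℕ) : Prop :=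
  (∃ p, ProgForFun Ψ p F n) ∧
    ∃ d, F d = some x ∧ Nat.dist (KFun Ψ n F + d.length) (Φ.C x (KFun Ψ n F) n) ≤ c

/-- typical semimeasure: `−log P(x) = K(x|P*) ± c`, `P*` a shortest plain description of `P`. -/
def TypicalProb (Φ Ψ : Machine) (c n x : ℕ) (P : ℕ → ℚ) : Prop :=
  IsSemimeasure n P ∧ (∃ p, ProgForProb Ψ p P n) ∧
    ∀ p : List Bool, ProgForProb Ψ p P n → p.length = KProb Ψ n P →
      |(-Real.logb 2 (P x)) - (Φ.C x (Encodable.encode p) n : ℝ)| ≤ c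

/-- the `BB`-depth `k'_x` with additive constant `d`:
`k'_x = min { k : K_{BB(k)}(x|k) ≤ K(x|k) + d }`. -/
noncomputable def kBB (Φ Ψ : Machine) (d n x : ℕ) : ℕ :=
  sInf {k | ∃ p : List Bool, p.length ≤ Φ.C x k n + d ∧ Φ.step (Ψ.BB n k) p k n = some x}

/-- The explicit weak sufficient statistic `P'_x`, with constants `d` (for `k'_x`),
`c` (scaling) and `c₂` (difference threshold):
`P'_x(y) = 2^{−K_{BB(k'_x)}(y|k'_x) + k'_x − c}` when
`K_{BB(k'_x)}(y|k'_x)` and `K_{BB(k'_x−1)}(y|k'_x)` differ by more than `c₂`, else `0`. -/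
noncomputable def Pprime (Φ Ψ : Machine) (d c c₂ n x : ℕ) (y : ℕ) : ℚ :=
  if Φ.Ct (Ψ.BB n (kBB Φ Ψ d n x)) y (kBB Φ Ψ d n x) n + (c₂ : ℕ∞) <
      Φ.Ct (Ψ.BB n (kBB Φ Ψ d n x - 1)) y (kBB Φ Ψ d n x) n then
    (2 : ℚ) ^ (kBB Φ Ψ d n x) /
      2 ^ (c + (Φ.Ct (Ψ.BB n (kBB Φ Ψ d n x)) y (kBB Φ Ψ d n x) n).toNat)
  else 0

/-- A prefix-free oracle machine: `step t p y n w` where `w` is the length-`t` initial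
segment of the oracle which may be queried within `t` steps. -/
structure OracleMachine where
  step : ℕ → List Bool → ℕ → ℕ → List Bool → Option ℕ
  computable_step :
    Computable fun q : ((ℕ × List Bool) × ℕ × ℕ) × List Bool =>
      step q.1.1.1 q.1.1.2 q.1.2.1 q.1.2.2 q.2
  mono : ∀ {t t' : ℕ} {p : List Bool} {y n v : ℕ} (O : ℕ → Bool), t ≤ t' →
      step t p y n (List.ofFn fun i : Fin t => O i) = some v →
      step t' p y n (List.ofFn fun i : Fin t' => O i) = some v

namespace OracleMachine

variable (M : OracleMachine) (O : ℕ → Bool)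

def Outputs (p : List Bool) (y n v : ℕ) : Prop :=
  ∃ t, M.step t p y n (List.ofFn fun i : Fin t => O i) = some v

def HaltsOn (p : List Bool) (y n : ℕ) : Prop := ∃ v, M.Outputs O p y n v

def PrefixFree : Prop :=
  ∀ {p q : List Bool} {y n : ℕ}, M.HaltsOn O p y n → M.HaltsOn O q y n → p <+: q → p = q

/-- oracle Kolmogorov complexity `K^O`. -/
def C (x y n : ℕ) : ℕ := sInf {l | ∃ p : List Bool, p.length = l ∧ M.Outputs O p y n x}

def Total : Prop := ∀ x y n, ∃ p : List Bool, M.Outputs O p y n x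

/-- `M` is an optimal universal prefix-free machine relative to the oracle `O`. -/
def POptimal : Prop := M.PrefixFree O ∧ M.Total O ∧
  ∀ N : OracleMachine, N.PrefixFree O → ∃ c, ∀ (p : List Bool) (y n v : ℕ),
    N.Outputs O p y n v → M.C O v y n ≤ p.length + c

end OracleMachine

/-- The Halting sequence of `Φ` as a single oracle (pairing index and length parameter). -/
noncomputable def Hseq (Φ : Machine) : ℕ → Bool :=
  fun i => decide (Φ.HaltsOn (strOfNat i.unpair.1) 0 i.unpair.2)

end
theorem Computable.list_map {α β σ : Type*} [Primcodable α] [Primcodable β] [Primcodable σ]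
    {f : α → List β} {g : α → β → σ} (hf : Computable f) (hg : Computable₂ g) :
    Computable fun a => (f a).map (g a) := by
  have step : Computable₂ fun (a : α) (q : ℕ × List σ) =>
      ((f a)[q.1]?.map (g a)).elim q.2 fun c => q.2 ++ [c] := by
    refine (Computable.option_casesOn
      (o := fun z : α × ℕ × List σ => (f z.1)[z.2.1]?.map (g z.1)) (f := fun z => z.2.2)
      (g := fun z c => z.2.2 ++ [c]) ?_ (Computable.snd.comp Computable.snd) ?_).of_eq ?_
    · exact Computable.option_map
        (Computable.list_getElem?.comp (hf.comp Computable.fst)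
          (Computable.fst.comp Computable.snd))
        (hg.comp (Computable.fst.comp Computable.fst) Computable.snd).to₂
    · exact Computable.list_concat.comp
        (Computable.snd.comp (Computable.snd.comp Computable.fst)) Computable.snd
    · intro z
      dsimp only
      cases (f z.1)[z.2.1]?.map (g z.1) <;> rfl
  refine (Computable.nat_rec (Computable.list_length.comp hf) (Computable.const []) step).of_eq ?_
  intro a
  have key : ∀ i ≤ (f a).length,
      (Nat.rec [] (fun y IH => ((f a)[y]?.map (g a)).elim IH fun c => IH ++ [c]) i : List σ) =
        ((f a).take i).map (g a) := by
    intro i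
    induction i with
    | zero => simp
    | succ i ih =>
      intro hi
      have hi' : i < (f a).length := hi
      simp only [ih hi'.le, List.getElem?_eq_getElem hi', Option.map_some, Option.elim_some,
        List.take_succ_eq_append_getElem hi', List.map_append, List.map_cons, List.map_nil]
  simpa using key _ le_rfl

theorem Primrec.nat_pow : Primrec₂ ((· ^ ·) : ℕ → ℕ → ℕ) :=
  (Primrec.nat_rec' Primrec.snd (Primrec.const 1)
    (Primrec.nat_mul.comp (Primrec.snd.comp Primrec.snd)
      (Primrec.fst.comp Primrec.fst)).to₂).of_eq fun z => by
    obtain ⟨a, b⟩ := z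
    induction b with
    | zero => rfl
    | succ b ih => simp only [pow_succ] at ih ⊢; rw [← ih]

theorem Primrec.list_sum : Primrec (List.sum : List ℕ → ℕ) :=
  (Primrec.list_foldr Primrec.id (Primrec.const 0)
    (Primrec.nat_add.comp (Primrec.fst.comp Primrec.snd)
      (Primrec.snd.comp Primrec.snd)).to₂).of_eq fun l => by
    induction l <;> simp_all

/-- All binary strings of length at most `L`. -/
def stringsUpTo : ℕ → List (List Bool)
  | 0 => [[]]
  | L + 1 => [] :: (stringsUpTo L).flatMap fun p => [false :: p, true :: p]

theorem mem_stringsUpTo {L : ℕ} {p : List Bool} : p ∈ stringsUpTo L ↔ p.length ≤ L := by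
  induction L generalizing p with
  | zero => simp [stringsUpTo]
  | succ L ih =>
    cases p with
    | nil => simp [stringsUpTo]
    | cons b p => cases b <;> simp [stringsUpTo, ih]

theorem nodup_stringsUpTo (L : ℕ) : (stringsUpTo L).Nodup := by
  induction L with
  | zero => simp [stringsUpTo]
  | succ L ih =>
    refine List.nodup_cons.2 ⟨by simp, List.nodup_flatMap.2 ⟨by simp, ?_⟩⟩
    refine ih.imp fun {a b} hab => ?_
    simp [Function.onFun, hab.symm]

theorem length_stringsUpTo (L : ℕ) : (stringsUpTo L).length + 1 = 2 ^ (L + 1) := by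
  induction L with
  | zero => rfl
  | succ L ih =>
    have : (stringsUpTo (L + 1)).length = 2 * (stringsUpTo L).length + 1 := by
      simp [stringsUpTo, List.length_flatMap, mul_comm]
    rw [this, pow_succ, ← ih]
    ring

theorem primrec_stringsUpTo : Primrec stringsUpTo := by
  refine (Primrec.nat_rec₁ [[]] (f := fun _ l =>
    [] :: l.flatMap fun p : List Bool => [false :: p, true :: p]) ?_).of_eq ?_
  · refine Primrec.list_cons.comp (Primrec.const []) (Primrec.list_flatMap Primrec.snd ?_)
    exact Primrec.list_cons.comp (Primrec.list_cons.comp (Primrec.const false) Primrec.snd)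
      (Primrec.list_cons.comp (Primrec.list_cons.comp (Primrec.const true) Primrec.snd)
        (Primrec.const []))
  · intro L
    induction L with
    | zero => rfl
    | succ L ih => simp only [stringsUpTo, ← ih]

/-- The number with the given binary digits, least significant first. -/
def natOfBits (σ : List Bool) : ℕ := σ.foldr (fun b m => b.toNat + 2 * m) 0

theorem primrec_natOfBits : Primrec natOfBits :=
  Primrec.list_foldr Primrec.id (Primrec.const 0)
    (Primrec.nat_add.comp ((Primrec.dom_finite Bool.toNat).comp (Primrec.fst.comp Primrec.snd))
      (Primrec.nat_mul.comp (Primrec.const 2) (Primrec.snd.comp Primrec.snd))).to₂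

theorem exists_natOfBits_eq {k m : ℕ} (hm : m < 2 ^ k) :
    ∃ σ : List Bool, σ.length = k ∧ natOfBits σ = m := by
  induction k generalizing m with
  | zero => exact ⟨[], rfl, by simp [natOfBits]; omega⟩
  | succ k ih =>
    obtain ⟨σ, hσ, hv⟩ := ih (m := m / 2) (by rw [pow_succ] at hm; omega)
    refine ⟨decide (m % 2 = 1) :: σ, by simp [hσ], ?_⟩
    have : natOfBits (decide (m % 2 = 1) :: σ) =
      (decide (m % 2 = 1)).toNat + 2 * natOfBits σ := rfl
    rw [this, hv]
    rcases Nat.mod_two_eq_zero_or_one m with h | h <;> simp [h] <;> omega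

/-- The number of leading ones of a binary string. -/
def leadingOnes (q : List Bool) : ℕ := q.findIdx fun b => !b

theorem primrec_leadingOnes : Primrec leadingOnes :=
  Primrec.list_findIdx Primrec.id (Primrec.not.comp Primrec.snd).to₂

theorem leadingOnes_replicate_append (c : ℕ) (σ : List Bool) :
    leadingOnes (List.replicate c true ++ false :: σ) = c := by
  induction c with
  | zero => simp [leadingOnes, List.findIdx_cons]
  | succ c ih => simpa [leadingOnes, List.replicate_succ, List.findIdx_cons] using ih

theorem leadingOnes_eq_of_prefix {p q : List Bool} (h : p <+: q)
    (hp : leadingOnes p < p.length) : leadingOnes p = leadingOnes q := by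
  obtain ⟨r, rfl⟩ := h
  unfold leadingOnes at *
  rw [List.findIdx_append, if_pos hp]

theorem computable_decide_and {α : Type*} [Primcodable α] {P Q : α → Prop}
    [DecidablePred P] [DecidablePred Q] (hP : PrimrecPred P)
    (hQ : Computable fun a => decide (Q a)) :
    Computable fun a => decide (P a ∧ Q a) :=
  (Primrec.and.to_comp.comp hP.decide.to_comp hQ).of_eq fun a => by
    rw [Bool.eq_iff_iff]
    simp

/-- The partial function evaluating `g` at the first time when `P` holds. -/
theorem exists_partrec_at_first {α : Type*} [Primcodable α] {P : α → ℕ → Prop}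
    [∀ a s, Decidable (P a s)] {g : α → ℕ → Option ℕ}
    (hP : Computable fun w : α × ℕ => decide (P w.1 w.2))
    (hg : Computable fun w : α × ℕ => g w.1 w.2) :
    ∃ f : α →. ℕ, Partrec f ∧
      ∀ a v, v ∈ f a ↔ ∃ s, P a s ∧ (∀ r < s, ¬ P a r) ∧ g a s = some v := by
  have hfind : Partrec fun a => Nat.rfind fun s => Part.some (decide (P a s)) :=
    Partrec.rfind hP.partrec.to₂
  refine ⟨_, hfind.bind (Computable.ofOption hg).to₂, fun a v => ?_⟩
  simp only [Part.mem_bind_iff, Part.mem_ofOption, Option.mem_def]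
  refine exists_congr fun s => ?_
  rw [← and_assoc]
  refine and_congr_left' (Nat.mem_rfind.trans ?_)
  simp

namespace Machine

theorem exists_outputs_iff {f : List Bool × ℕ × ℕ →. ℕ} (hf : Partrec f) :
    ∃ N : Machine, ∀ p y n v, N.Outputs p y n v ↔ v ∈ f (p, y, n) := by
  obtain ⟨c, hc⟩ := Nat.Partrec.Code.exists_code.1 hf
  refine ⟨⟨fun t p y n => Nat.Partrec.Code.evaln t c (Encodable.encode (p, y, n)), ?_, ?_⟩, ?_⟩
  · refine (Nat.Partrec.Code.primrec_evaln.comp (Primrec.pair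
      (Primrec.pair (Primrec.fst.comp Primrec.fst) (Primrec.const c))
      (Primrec.encode.comp (Primrec.pair (Primrec.snd.comp Primrec.fst) Primrec.snd)))).to_comp
  · exact fun h h' => Nat.Partrec.Code.evaln_mono h h'
  · intro p y n v
    refine Nat.Partrec.Code.evaln_complete.symm.trans ?_
    rw [hc]
    simp

variable {Φ : Machine}

theorem Outputs.unique {p : List Bool} {y n v w : ℕ} (h : Φ.Outputs p y n v)
    (h' : Φ.Outputs p y n w) : v = w := by
  obtain ⟨t, ht⟩ := h
  obtain ⟨s, hs⟩ := h'
  have h₁ := Φ.mono (le_max_left t s) ht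
  have h₂ := Φ.mono (le_max_right t s) hs
  exact Option.some.inj (h₁.symm.trans h₂)

theorem exists_outputs_C (hT : Φ.Total) (x y n : ℕ) :
    ∃ p : List Bool, p.length = Φ.C x y n ∧ Φ.Outputs p y n x := by
  obtain ⟨p, hp⟩ := hT x y n
  exact Nat.sInf_mem (s := {l | ∃ p : List Bool, p.length = l ∧ Φ.Outputs p y n x})
    ⟨_, p, rfl, hp⟩

theorem POptimal.exists_translation (hΦ : Φ.POptimal) {f : List Bool × ℕ × ℕ →. ℕ}
    (hf : Partrec f)
    (hpf : ∀ p q y n, (f (p, y, n)).Dom → (f (q, y, n)).Dom → p <+: q → p = q) :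
    ∃ e, ∀ p y n v, v ∈ f (p, y, n) →
      ∃ q : List Bool, q.length ≤ p.length + e ∧ Φ.Outputs q y n v := by
  obtain ⟨N, hN⟩ := exists_outputs_iff hf
  obtain ⟨e, he⟩ := hΦ.2.2 N (by
    rintro p q y n ⟨v, hv⟩ ⟨w, hw⟩
    exact hpf p q y n (Part.dom_iff_mem.2 ⟨v, (hN ..).1 hv⟩)
      (Part.dom_iff_mem.2 ⟨w, (hN ..).1 hw⟩))
  refine ⟨e, fun p y n v hv => ?_⟩
  obtain ⟨q, hq, ho⟩ := exists_outputs_C hΦ.2.1 v y n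
  exact ⟨q, hq ▸ he p y n v ((hN ..).2 hv), ho⟩

variable (Φ)

/-- The values produced in `s` steps by programs of length at most `L`. -/
def found (L s n : ℕ) : List ℕ := (stringsUpTo L).filterMap fun p => Φ.step s p 0 n

/-- The elements of `2^n` not produced in `s` steps by programs of length at most `L`. -/
def fresh (L s n : ℕ) : List ℕ := (List.range (2 ^ n)).filter fun v => v ∉ Φ.found L s n

/-- `2^s` times the mass of the programs of length at most `s` producing an element of `2^n`
in `s` steps. -/
def mass (s n : ℕ) : ℕ :=
  ((stringsUpTo s).map fun p =>
    (Φ.step s p 0 n).elim 0 fun v => if v < 2 ^ n then 2 ^ (s - p.length) else 0).sum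

/-- The first `k` bits of the approximation of `Ω^n` given by `mass`. -/
def level (k s n : ℕ) : ℕ := Φ.mass s n * 2 ^ k / 2 ^ s

theorem computable_step_zero {α : Type*} [Primcodable α] {s n : α → ℕ} {p : α → List Bool}
    (hs : Computable s) (hp : Computable p) (hn : Computable n) :
    Computable fun a => Φ.step (s a) (p a) 0 (n a) :=
  Φ.computable_step.comp
    (Computable.pair (Computable.pair hs hp) (Computable.pair (Computable.const 0) hn))

theorem computable_found :
    Computable fun z : ℕ × ℕ × ℕ => Φ.found z.1 z.2.1 z.2.2 := by
  have h : Computable fun z : ℕ × ℕ × ℕ =>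
      (stringsUpTo z.1).map fun p => Φ.step z.2.1 p 0 z.2.2 :=
    Computable.list_map (primrec_stringsUpTo.to_comp.comp Computable.fst)
      (Φ.computable_step_zero (Computable.fst.comp (Computable.snd.comp Computable.fst))
        Computable.snd (Computable.snd.comp (Computable.snd.comp Computable.fst)))
  refine ((Primrec.listFilterMap Primrec.id Primrec.snd.to₂).to_comp.comp h).of_eq fun z => ?_
  simp [found, List.filterMap_map]

theorem primrecRel_notMem : PrimrecRel fun (v : ℕ) (l : List ℕ) => v ∉ l :=
  (PrimrecPred.not ((PrimrecRel.exists_mem_list (R := fun a b : ℕ => a = b) Primrec.eq).comp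
    Primrec.snd Primrec.fst)).of_eq (by simp)

theorem computable_fresh :
    Computable fun z : ℕ × ℕ × ℕ => Φ.fresh z.1 z.2.1 z.2.2 :=
  (primrecRel_notMem.listFilter.to_comp).comp
    (Primrec.list_range.comp (Primrec.nat_pow.comp (Primrec.const 2)
      (Primrec.snd.comp Primrec.snd))).to_comp
    Φ.computable_found

theorem computable_level :
    Computable fun z : ℕ × ℕ × ℕ => Φ.level z.1 z.2.1 z.2.2 := by
  have hw : Computable₂ fun (z : ℕ × ℕ) (p : List Bool) => (Φ.step z.1 p 0 z.2).elim 0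
      fun v => if v < 2 ^ z.2 then 2 ^ (z.1 - p.length) else 0 := by
    refine (Computable.option_casesOn
      (o := fun w : (ℕ × ℕ) × List Bool => Φ.step w.1.1 w.2 0 w.1.2) (f := fun _ => 0)
      (g := fun w v => if v < 2 ^ w.1.2 then 2 ^ (w.1.1 - w.2.length) else 0)
      (Φ.computable_step_zero (Computable.fst.comp Computable.fst) Computable.snd
        (Computable.snd.comp Computable.fst)) (Computable.const 0) ?_).of_eq fun w => ?_
    · refine Primrec.to_comp (Primrec.ite ?_ ?_ (Primrec.const 0))
      · exact Primrec.nat_lt.comp Primrec.snd (Primrec.nat_pow.comp (Primrec.const 2)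
          (Primrec.snd.comp (Primrec.fst.comp Primrec.fst)))
      · exact Primrec.nat_pow.comp (Primrec.const 2) (Primrec.nat_sub.comp
          (Primrec.fst.comp (Primrec.fst.comp Primrec.fst))
          (Primrec.list_length.comp (Primrec.snd.comp Primrec.fst)))
    · dsimp only
      cases Φ.step w.1.1 w.2 0 w.1.2 <;> rfl
  have hm : Computable fun z : ℕ × ℕ => Φ.mass z.1 z.2 :=
    Primrec.list_sum.to_comp.comp
      (Computable.list_map (primrec_stringsUpTo.to_comp.comp Computable.fst) hw)
  have hp : Computable fun k : ℕ => 2 ^ k :=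
    (Primrec.nat_pow.comp (Primrec.const 2) Primrec.id).to_comp
  exact Primrec.nat_div.to_comp.comp
    (Primrec.nat_mul.to_comp.comp (hm.comp Computable.snd) (hp.comp Computable.fst))
    (hp.comp (Computable.fst.comp Computable.snd))

theorem computable_found_comp {α : Type*} [Primcodable α] {L s n : α → ℕ} (hL : Computable L)
    (hs : Computable s) (hn : Computable n) : Computable fun a => Φ.found (L a) (s a) (n a) :=
  Φ.computable_found.comp (hL.pair (hs.pair hn))

theorem computable_fresh_comp {α : Type*} [Primcodable α] {L s n : α → ℕ} (hL : Computable L)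
    (hs : Computable s) (hn : Computable n) : Computable fun a => Φ.fresh (L a) (s a) (n a) :=
  Φ.computable_fresh.comp (hL.pair (hs.pair hn))

theorem computable_level_comp {α : Type*} [Primcodable α] {k s n : α → ℕ} (hk : Computable k)
    (hs : Computable s) (hn : Computable n) : Computable fun a => Φ.level (k a) (s a) (n a) :=
  Φ.computable_level.comp (hk.pair (hs.pair hn))

variable {Φ}

theorem mem_found {L s n v : ℕ} :
    v ∈ Φ.found L s n ↔ ∃ p : List Bool, p.length ≤ L ∧ Φ.step s p 0 n = some v := by
  simp [found, mem_stringsUpTo]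

theorem found_mono {L s t n : ℕ} (h : s ≤ t) : Φ.found L s n ⊆ Φ.found L t n := by
  intro v hv
  obtain ⟨p, hp, hs⟩ := mem_found.1 hv
  exact mem_found.2 ⟨p, hp, Φ.mono h hs⟩

theorem mem_fresh {L s n v : ℕ} : v ∈ Φ.fresh L s n ↔ v < 2 ^ n ∧ v ∉ Φ.found L s n := by
  simp [fresh]

theorem fresh_sublist {L s t n : ℕ} (h : s ≤ t) :
    (Φ.fresh L t n).Sublist (Φ.fresh L s n) :=
  List.monotone_filter_right _ fun v hv => by
    simp only [decide_eq_true_eq] at hv ⊢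
    exact fun hs => hv (found_mono h hs)

theorem lt_length_fresh {L s n m : ℕ} (hL : L + 2 ≤ n) (hm : m < 2 ^ (n - 1)) :
    m < (Φ.fresh L s n).length := by
  have h₁ : (Φ.fresh L s n).toFinset = Finset.range (2 ^ n) \ (Φ.found L s n).toFinset := by
    ext v
    simp [mem_fresh]
  have h₂ : (Φ.fresh L s n).toFinset.card ≤ (Φ.fresh L s n).length := List.toFinset_card_le _
  have h₃ : (Φ.found L s n).toFinset.card ≤ (Φ.found L s n).length := List.toFinset_card_le _
  have h₄ : (Φ.found L s n).length ≤ (stringsUpTo L).length := List.length_filterMap_le _ _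
  have h₅ := Finset.le_card_sdiff (Φ.found L s n).toFinset (Finset.range (2 ^ n))
  have h₆ := length_stringsUpTo L
  have h₇ : 2 ^ (L + 1) ≤ 2 ^ (n - 1) := Nat.pow_le_pow_right (by norm_num) (by omega)
  have h₈ : 2 ^ n = 2 * 2 ^ (n - 1) := by
    rw [← pow_succ']
    congr 1
    omega
  rw [Finset.card_range] at h₅
  rw [h₁] at h₂
  omega

theorem fresh_getElem?_ne {L s t n i j v w : ℕ} (hst : s ≤ t) (hij : i < j)
    (hv : (Φ.fresh L s n)[i]? = some v) (hw : (Φ.fresh L t n)[j]? = some w) : v ≠ w := by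
  obtain ⟨f, hf⟩ := List.sublist_iff_exists_orderEmbedding_getElem?_eq.1
    (fresh_sublist (Φ := Φ) (L := L) (n := n) hst)
  rintro rfl
  have hnd : (Φ.fresh L s n).Nodup := List.nodup_range.filter _
  rw [hf j] at hw
  have hlt : i < (Φ.fresh L s n).length := (List.getElem?_eq_some_iff.1 hv).1
  have := (List.getElem?_inj hlt hnd).1 (hv.trans hw.symm)
  have := f.strictMono.le_apply (x := j)
  omega

/-- The weight of a program. -/
noncomputable def weight (p : List Bool) : ℝ := 2 ^ (-(p.length : ℤ))

theorem weight_pos (p : List Bool) : 0 < weight p := by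
  unfold weight
  positivity

variable (Φ)

/-- The programs producing an element of `2^n`. -/
def producing (n : ℕ) : Set (List Bool) := {p | ∃ v, v < 2 ^ n ∧ Φ.Outputs p 0 n v}

/-- The programs producing an element of `2^n` in `t` steps. -/
def producingIn (n t : ℕ) : Set (List Bool) := {p | ∃ v, v < 2 ^ n ∧ Φ.step t p 0 n = some v}

theorem Omega_eq (n : ℕ) : Φ.Omega n = ∑' p, (Φ.producing n).indicator weight p := by
  refine tsum_congr fun p => ?_
  rw [Set.indicator_apply]
  congr

theorem OmegaT_eq (n t : ℕ) : Φ.OmegaT n t = ∑' p, (Φ.producingIn n t).indicator weight p := by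
  refine tsum_congr fun p => ?_
  rw [Set.indicator_apply]
  congr

variable {Φ}

theorem producingIn_subset (n t : ℕ) : Φ.producingIn n t ⊆ Φ.producing n :=
  fun _ ⟨v, hv, ht⟩ => ⟨v, hv, t, ht⟩

theorem producingIn_mono (n : ℕ) : Monotone (Φ.producingIn n) :=
  fun _ _ h _ ⟨v, hv, ht⟩ => ⟨v, hv, Φ.mono h ht⟩

theorem uniquelyDecodable_of_prefixFree {S : Set (List Bool)}
    (hS : ∀ p ∈ S, ∀ q ∈ S, p <+: q → p = q) (h : [] ∉ S) :
    InformationTheory.UniquelyDecodable S := by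
  intro L₁
  induction L₁ with
  | nil =>
    rintro (_ | ⟨q, L₂⟩) _ h₂ he
    · rfl
    · have : q = [] := by simp_all
      exact absurd (this ▸ h₂ q (by simp)) h
  | cons p L₁ ih =>
    rintro (_ | ⟨q, L₂⟩) h₁ h₂ he
    · have : p = [] := by simp_all
      exact absurd (this ▸ h₁ p (by simp)) h
    · simp only [List.flatten_cons] at he
      have hpq : p = q := by
        rcases List.prefix_or_prefix_of_prefix (List.prefix_append p L₁.flatten)
          (he ▸ List.prefix_append q L₂.flatten) with hp | hq
        · exact hS p (h₁ p (by simp)) q (h₂ q (by simp)) hp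
        · exact (hS q (h₂ q (by simp)) p (h₁ p (by simp)) hq).symm
      subst hpq
      rw [ih L₂ (fun w hw => h₁ w (by simp [hw])) (fun w hw => h₂ w (by simp [hw]))
        (List.append_cancel_left he)]

theorem sum_weight_le_one {S : Finset (List Bool)}
    (hS : ∀ p ∈ S, ∀ q ∈ S, p <+: q → p = q) : ∑ p ∈ S, weight p ≤ 1 := by
  by_cases h : [] ∈ S
  · have : S = {[]} := by
      refine Finset.eq_singleton_iff_unique_mem.2 ⟨h, fun q hq => ?_⟩
      exact (hS [] h q hq (List.nil_prefix)).symm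
    simp [this, weight]
  · have := InformationTheory.kraft_mcmillan_inequality
      (uniquelyDecodable_of_prefixFree (S := (S : Set (List Bool))) hS (by simpa using h))
    simpa [weight] using this

theorem sum_indicator_weight_le_one (hΦ : Φ.PrefixFree) {n : ℕ} (F : Finset (List Bool)) :
    ∑ p ∈ F, (Φ.producing n).indicator weight p ≤ 1 := by
  rw [Finset.sum_indicator_eq_sum_filter]
  refine sum_weight_le_one fun p hp q hq h => ?_
  obtain ⟨v, -, hv⟩ := (Finset.mem_filter.1 hp).2
  obtain ⟨w, -, hw⟩ := (Finset.mem_filter.1 hq).2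
  exact hΦ ⟨v, hv⟩ ⟨w, hw⟩ h

theorem indicator_weight_nonneg (S : Set (List Bool)) (p : List Bool) :
    0 ≤ S.indicator weight p :=
  Set.indicator_nonneg (fun q _ => (weight_pos q).le) p

theorem summable_indicator_producing (hΦ : Φ.PrefixFree) (n : ℕ) :
    Summable ((Φ.producing n).indicator weight) :=
  summable_of_sum_le (indicator_weight_nonneg _) fun F => sum_indicator_weight_le_one hΦ F

theorem summable_indicator_of_subset (hΦ : Φ.PrefixFree) {n : ℕ} {S : Set (List Bool)}
    (hS : S ⊆ Φ.producing n) : Summable (S.indicator weight) :=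
  (summable_indicator_producing hΦ n).of_nonneg_of_le (indicator_weight_nonneg _)
    fun p => Set.indicator_le_indicator_of_subset hS (fun q => (weight_pos q).le) p

theorem Omega_le_one (hΦ : Φ.PrefixFree) (n : ℕ) : Φ.Omega n ≤ 1 := by
  rw [Omega_eq]
  exact Real.tsum_le_of_sum_le (indicator_weight_nonneg _) fun F => sum_indicator_weight_le_one hΦ F

theorem OmegaT_mono (hΦ : Φ.PrefixFree) (n : ℕ) : Monotone (Φ.OmegaT n) := fun s t h => by
  rw [OmegaT_eq, OmegaT_eq]
  exact (summable_indicator_of_subset hΦ (producingIn_subset n s)).tsum_le_tsum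
    (fun p => Set.indicator_le_indicator_of_subset (producingIn_mono n h)
      (fun q => (weight_pos q).le) p)
    (summable_indicator_of_subset hΦ (producingIn_subset n t))

theorem sum_weight_le_OmegaT (hΦ : Φ.PrefixFree) {n t : ℕ} {F : Finset (List Bool)}
    (hF : ∀ p ∈ F, p ∈ Φ.producingIn n t) : ∑ p ∈ F, weight p ≤ Φ.OmegaT n t := by
  rw [OmegaT_eq, Finset.sum_congr rfl fun p hp => (Set.indicator_of_mem (hF p hp) weight).symm]
  exact (summable_indicator_of_subset hΦ (producingIn_subset n t)).sum_le_tsum F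
    fun p _ => indicator_weight_nonneg _ p

/-- Programs that halt only after time `t` account for part of `Ω^n - Ω^n_t`. -/
theorem sum_weight_le_Omega_sub_OmegaT (hΦ : Φ.PrefixFree) {n t : ℕ} {F : Finset (List Bool)}
    (hF : ∀ p ∈ F, p ∈ Φ.producing n) (hF' : ∀ p ∈ F, p ∉ Φ.producingIn n t) :
    ∑ p ∈ F, weight p ≤ Φ.Omega n - Φ.OmegaT n t := by
  have hs := summable_indicator_producing hΦ n
  have ht := summable_indicator_of_subset hΦ (producingIn_subset n t)
  rw [Omega_eq, OmegaT_eq, ← hs.tsum_sub ht]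
  have h : ∀ p ∈ F, weight p =
      (Φ.producing n).indicator weight p - (Φ.producingIn n t).indicator weight p := by
    intro p hp
    rw [Set.indicator_of_mem (hF p hp), Set.indicator_of_notMem (hF' p hp), sub_zero]
  rw [Finset.sum_congr rfl h]
  exact (hs.sub ht).sum_le_tsum F fun p _ => sub_nonneg.2
    (Set.indicator_le_indicator_of_subset (producingIn_subset n t) (fun q => (weight_pos q).le) p)

theorem OmegaT_le_Omega (hΦ : Φ.PrefixFree) (n t : ℕ) : Φ.OmegaT n t ≤ Φ.Omega n := by
  simpa using sum_weight_le_Omega_sub_OmegaT hΦ (n := n) (t := t) (F := ∅) (by simp) (by simp)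

theorem exists_finset_producingIn (hΦ : Φ.PrefixFree) (n : ℕ) {ε : ℝ} (hε : 0 < ε) :
    ∃ (F : Finset (List Bool)) (t : ℕ), (∀ p ∈ F, p ∈ Φ.producingIn n t) ∧
      Φ.Omega n - ε < ∑ p ∈ F, weight p := by
  have h := (summable_indicator_producing hΦ n).hasSum
  rw [← Omega_eq] at h
  obtain ⟨F, hF⟩ := (h.eventually (lt_mem_nhds (sub_lt_self (Φ.Omega n) hε))).exists
  rw [Finset.sum_indicator_eq_sum_filter] at hF
  set G := F.filter fun p => p ∈ Φ.producing n with hG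
  have hGt : ∃ t, ∀ p ∈ G, p ∈ Φ.producingIn n t := by
    have : ∀ p ∈ G, ∃ t, p ∈ Φ.producingIn n t := fun p hp => by
      obtain ⟨v, hv, t, ht⟩ := (Finset.mem_filter.1 hp).2
      exact ⟨t, v, hv, ht⟩
    choose! τ hτ using this
    exact ⟨G.sup τ, fun p hp => producingIn_mono n (Finset.le_sup hp) (hτ p hp)⟩
  obtain ⟨t, ht⟩ := hGt
  exact ⟨G, t, ht, hF⟩

theorem Omega_sub_OmegaT_tk_le (hΦ : Φ.PrefixFree) (n k : ℕ) :
    Φ.Omega n - Φ.OmegaT n (Φ.tk n k) ≤ (2 : ℝ) ^ (-(k : ℤ)) := by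
  obtain ⟨F, t, hF, hlt⟩ := exists_finset_producingIn hΦ n
    (show (0 : ℝ) < 2 ^ (-(k : ℤ)) by positivity)
  have := sum_weight_le_OmegaT hΦ hF
  exact Nat.sInf_mem (s := {t | Φ.Omega n - Φ.OmegaT n t ≤ (2 : ℝ) ^ (-(k : ℤ))})
    ⟨t, by simp only [Set.mem_ofPred_eq]; linarith⟩

theorem mass_eq (s n : ℕ) : (Φ.mass s n : ℝ) =
    2 ^ s * ∑ p ∈ (stringsUpTo s).toFinset.filter (· ∈ Φ.producingIn n s), weight p := by
  rw [mass, ← List.sum_toFinset _ (nodup_stringsUpTo s), Finset.sum_filter, Finset.mul_sum]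
  push_cast
  refine Finset.sum_congr rfl fun p hp => ?_
  have hl : p.length ≤ s := mem_stringsUpTo.1 (List.mem_toFinset.1 hp)
  have hw : (2 : ℝ) ^ s * weight p = 2 ^ (s - p.length) := by
    rw [weight, zpow_neg, zpow_natCast, pow_sub₀ _ two_ne_zero hl]
  have hP : p ∈ Φ.producingIn n s ↔ ∃ v, v < 2 ^ n ∧ Φ.step s p 0 n = some v := Iff.rfl
  rw [mul_ite, hw, mul_zero]
  cases h : Φ.step s p 0 n with
  | none => simp [hP, h]
  | some v => by_cases hv : v < 2 ^ n <;> simp [hP, h, hv]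

theorem mass_div_mono (n : ℕ) : Monotone fun s => (Φ.mass s n : ℝ) / 2 ^ s := by
  intro s t h
  simp only [mass_eq, mul_div_cancel_left₀ _ (pow_ne_zero _ (two_ne_zero (α := ℝ)))]
  refine Finset.sum_le_sum_of_subset_of_nonneg (fun p hp => ?_) fun p _ _ => (weight_pos p).le
  simp only [Finset.mem_filter, List.mem_toFinset, mem_stringsUpTo] at hp ⊢
  exact ⟨hp.1.trans h, producingIn_mono n h hp.2⟩

theorem level_eq (k s n : ℕ) : Φ.level k s n = ⌊(Φ.mass s n : ℝ) / 2 ^ s * 2 ^ k⌋₊ := by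
  rw [div_mul_eq_mul_div, level, ← Nat.floor_div_eq_div (K := ℝ)]
  push_cast
  rfl

theorem level_mono (k n : ℕ) : Monotone fun s => Φ.level k s n := by
  intro s t h
  simp only [level_eq]
  have := mass_div_mono (Φ := Φ) n h
  dsimp only at this
  gcongr

theorem level_le (hΦ : Φ.PrefixFree) (k s n : ℕ) : (Φ.level k s n : ℝ) ≤ Φ.Omega n * 2 ^ k := by
  rw [level_eq]
  refine (Nat.floor_le (by positivity)).trans ?_
  gcongr
  rw [mass_eq, mul_div_cancel_left₀ _ (by positivity)]
  refine (sum_weight_le_OmegaT hΦ (t := s) fun p hp => ?_).trans (OmegaT_le_Omega hΦ n s)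
  exact (Finset.mem_filter.1 hp).2

theorem level_le_two_pow (hΦ : Φ.PrefixFree) (k s n : ℕ) : Φ.level k s n ≤ 2 ^ k := by
  have h := level_le hΦ k s n
  have h' : Φ.Omega n * 2 ^ k ≤ 1 * 2 ^ k := by
    gcongr
    exact Omega_le_one hΦ n
  rw [one_mul] at h'
  exact_mod_cast h.trans h'

theorem exists_lt_level_add_two (hΦ : Φ.PrefixFree) (k n : ℕ) :
    ∃ s, Φ.Omega n * 2 ^ k < Φ.level k s n + 2 := by
  obtain ⟨F, t, hF, hlt⟩ := exists_finset_producingIn hΦ n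
    (show (0 : ℝ) < (2 ^ k)⁻¹ by positivity)
  set s := max t (F.sup List.length)
  have h : ∑ p ∈ F, weight p ≤ (Φ.mass s n : ℝ) / 2 ^ s := by
    rw [mass_eq, mul_div_cancel_left₀ _ (by positivity)]
    refine Finset.sum_le_sum_of_subset_of_nonneg (fun p hp => ?_) fun p _ _ => (weight_pos p).le
    simp only [Finset.mem_filter, List.mem_toFinset, mem_stringsUpTo]
    exact ⟨(Finset.le_sup hp).trans (le_max_right _ _),
      producingIn_mono n (le_max_left _ _) (hF p hp)⟩
  refine ⟨s, ?_⟩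
  have hf := Nat.lt_floor_add_one ((Φ.mass s n : ℝ) / 2 ^ s * 2 ^ k)
  rw [← level_eq] at hf
  have h₁ : (Φ.Omega n - (2 ^ k)⁻¹) * 2 ^ k < (Φ.mass s n : ℝ) / 2 ^ s * 2 ^ k := by
    gcongr
    exact hlt.trans_le h
  rw [sub_mul, inv_mul_cancel₀ (by positivity)] at h₁
  linarith

theorem weight_ge_of_length_le {p : List Bool} {L : ℕ} (h : p.length ≤ L) :
    ((2 : ℝ) ^ L)⁻¹ ≤ weight p := by
  rw [weight, zpow_neg, zpow_natCast]
  gcongr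
  norm_num

theorem POptimal.exists_C_le (hΦ : Φ.POptimal) : ∃ c, ∀ n, ∀ x < 2 ^ n, Φ.C x 0 n ≤ n + c := by
  let f : List Bool × ℕ × ℕ →. ℕ := fun z =>
    ((if z.1.length = z.2.2 then some (natOfBits z.1) else none : Option ℕ) : Part ℕ)
  have hf : Partrec f := by
    refine Computable.ofOption (Primrec.to_comp (Primrec.ite ?_ ?_ (Primrec.const none)))
    · exact Primrec.eq.comp (Primrec.list_length.comp Primrec.fst)
        (Primrec.snd.comp Primrec.snd)
    · exact Primrec.option_some.comp (primrec_natOfBits.comp Primrec.fst)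
  have hlen : ∀ p y n, (f (p, y, n)).Dom → p.length = n := by
    intro p y n h
    by_contra hne
    simp [f, hne] at h
  obtain ⟨c, hc⟩ := hΦ.exists_translation hf fun p q y n hp hq h =>
    h.eq_of_length ((hlen p y n hp).trans (hlen q y n hq).symm)
  refine ⟨c, fun n x hx => ?_⟩
  obtain ⟨σ, hσ, rfl⟩ := exists_natOfBits_eq hx
  obtain ⟨q, hq, ho⟩ := hc σ 0 n (natOfBits σ) (by simp [f, hσ])
  exact (Nat.sInf_le (s := {l | ∃ p : List Bool, p.length = l ∧ Φ.Outputs p 0 n (natOfBits σ)})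
    ⟨q, rfl, ho⟩).trans (hσ ▸ hq)

/-- Every element of `2^n` is produced by a shortest program before time `t_{K(x) + 1}`. -/
theorem exists_step_tk_C_add_one (hΦ : Φ.POptimal) {n x : ℕ} (hx : x < 2 ^ n) :
    ∃ p : List Bool, p.length = Φ.C x 0 n ∧ Φ.step (Φ.tk n (Φ.C x 0 n + 1)) p 0 n = some x := by
  obtain ⟨p, hp, ho⟩ := exists_outputs_C hΦ.2.1 x 0 n
  refine ⟨p, hp, ?_⟩
  set t := Φ.tk n (Φ.C x 0 n + 1) with ht
  by_cases hin : p ∈ Φ.producingIn n t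
  · obtain ⟨v, -, hv⟩ := hin
    rwa [ho.unique ⟨t, hv⟩]
  · exfalso
    have h₁ := sum_weight_le_Omega_sub_OmegaT hΦ.1 (n := n) (t := t) (F := {p})
      (by simpa using ⟨x, hx, ho⟩) (by simpa using hin)
    have h₂ := Omega_sub_OmegaT_tk_le hΦ.1 n (Φ.C x 0 n + 1)
    rw [Finset.sum_singleton, weight, hp] at h₁
    have h₃ : (2 : ℝ) ^ (-((Φ.C x 0 n + 1 : ℕ) : ℤ)) < 2 ^ (-(Φ.C x 0 n : ℤ)) :=
      zpow_lt_zpow_right₀ (by norm_num) (by push_cast; omega)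
    linarith

theorem mdepth_le (hΦ : Φ.POptimal) (d : ℕ) {n x : ℕ} (hx : x < 2 ^ n) :
    Φ.mdepth d n x ≤ Φ.C x 0 n + 1 := by
  obtain ⟨p, hp, hs⟩ := exists_step_tk_C_add_one hΦ hx
  exact Nat.sInf_le ⟨p, by omega, hs⟩

/-- A time at which `x` has a program of nearly minimal length determines `Ω^n` up to
about `k_x` bits. -/
theorem Omega_sub_OmegaT_le_of_mem_found (hΦ : Φ.POptimal) {d n x t : ℕ}
    (ht : x ∈ Φ.found (Φ.C x 0 n + d) t n) :
    Φ.Omega n - Φ.OmegaT n t ≤ 2 * ((2 : ℝ) ^ Φ.mdepth d n x)⁻¹ := by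
  cases hk : Φ.mdepth d n x with
  | zero =>
    have h₁ := Omega_le_one hΦ.1 n
    have h₂ : 0 ≤ Φ.OmegaT n t := by simpa using sum_weight_le_OmegaT hΦ.1 (F := ∅) (by simp)
    norm_num
    linarith
  | succ k =>
    obtain ⟨p, hp, hs⟩ := mem_found.1 ht
    have hlt : Φ.tk n k ≤ t := by
      by_contra! hlt
      have : Φ.mdepth d n x ≤ k := Nat.sInf_le ⟨p, hp, Φ.mono hlt.le hs⟩
      omega
    have h₁ := OmegaT_mono hΦ.1 n hlt
    have h₂ := Omega_sub_OmegaT_tk_le hΦ.1 n k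
    have h₃ : 2 * ((2 : ℝ) ^ (k + 1))⁻¹ = 2 ^ (-(k : ℤ)) := by
      rw [zpow_neg, zpow_natCast, pow_succ]
      field_simp
    linarith

/-- For `2^n` large, there are `2^k` values, one for each `m`, that are fresh for `Φ` at the first
time when the approximation of `Ω^n` exceeds `m`, but have programs of length `n - 2`. -/
theorem POptimal.exists_fresh_translation (hΦ : Φ.POptimal) :
    ∃ e, ∀ n k s m v : ℕ, k + 2 * e + 3 = n → m < 2 ^ k → m < Φ.level k s n →
      (∀ r < s, Φ.level k r n ≤ m) → (Φ.fresh (n - 2) s n)[m]? = some v →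
      ∃ q : List Bool, q.length ≤ n - 2 ∧ Φ.Outputs q 0 n v := by
  have hlead : Primrec fun w : (List Bool × ℕ × ℕ) × ℕ => leadingOnes w.1.1 :=
    primrec_leadingOnes.comp (Primrec.fst.comp Primrec.fst)
  have hlength : Primrec fun w : (List Bool × ℕ × ℕ) × ℕ => w.1.1.length :=
    Primrec.list_length.comp (Primrec.fst.comp Primrec.fst)
  have hn : Primrec fun w : (List Bool × ℕ × ℕ) × ℕ => w.1.2.2 :=
    Primrec.snd.comp (Primrec.snd.comp Primrec.fst)
  have hindex : Primrec fun w : (List Bool × ℕ × ℕ) × ℕ =>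
      natOfBits (w.1.1.drop (leadingOnes w.1.1 + 1)) :=
    primrec_natOfBits.comp
      (Primrec.list_drop.comp (Primrec.succ.comp hlead) (Primrec.fst.comp Primrec.fst))
  have h₁ : PrimrecPred fun w : (List Bool × ℕ × ℕ) × ℕ => leadingOnes w.1.1 < w.1.1.length ∧
      w.1.1.length + leadingOnes w.1.1 + 2 = w.1.2.2 :=
    (Primrec.nat_lt.comp hlead hlength).and (Primrec.eq.comp
      (Primrec.nat_add.comp (Primrec.nat_add.comp hlength hlead) (Primrec.const 2)) hn)
  have hk : Primrec fun w : (List Bool × ℕ × ℕ) × ℕ => w.1.2.2 - (2 * leadingOnes w.1.1 + 3) :=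
    Primrec.nat_sub.comp hn (Primrec.nat_add.comp
      (Primrec.nat_mul.comp (Primrec.const 2) hlead) (Primrec.const 3))
  have hlevel : Computable fun w : (List Bool × ℕ × ℕ) × ℕ =>
      Φ.level (w.1.2.2 - (2 * leadingOnes w.1.1 + 3)) w.2 w.1.2.2 :=
    Φ.computable_level_comp hk.to_comp Computable.snd hn.to_comp
  have h₂ : Computable fun w : (List Bool × ℕ × ℕ) × ℕ =>
      decide (natOfBits (w.1.1.drop (leadingOnes w.1.1 + 1)) <
        Φ.level (w.1.2.2 - (2 * leadingOnes w.1.1 + 3)) w.2 w.1.2.2) :=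
    Primrec.nat_lt.decide.to_comp.comp hindex.to_comp hlevel
  have hfresh : Computable fun w : (List Bool × ℕ × ℕ) × ℕ =>
      Φ.fresh (w.1.2.2 - 2) w.2 w.1.2.2 :=
    Φ.computable_fresh_comp (Primrec.nat_sub.comp hn (Primrec.const 2)).to_comp
      Computable.snd hn.to_comp
  have hvalue : Computable fun w : (List Bool × ℕ × ℕ) × ℕ =>
      (Φ.fresh (w.1.2.2 - 2) w.2 w.1.2.2)[natOfBits (w.1.1.drop (leadingOnes w.1.1 + 1))]? :=
    Computable.list_getElem?.comp hfresh hindex.to_comp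
  obtain ⟨f, hf, hmem⟩ := exists_partrec_at_first
    (P := fun (z : List Bool × ℕ × ℕ) s =>
      (leadingOnes z.1 < z.1.length ∧ z.1.length + leadingOnes z.1 + 2 = z.2.2) ∧
        natOfBits (z.1.drop (leadingOnes z.1 + 1)) <
          Φ.level (z.2.2 - (2 * leadingOnes z.1 + 3)) s z.2.2)
    (g := fun z s =>
      (Φ.fresh (z.2.2 - 2) s z.2.2)[natOfBits (z.1.drop (leadingOnes z.1 + 1))]?)
    (computable_decide_and h₁ h₂) hvalue
  have hdom : ∀ z, (f z).Dom → leadingOnes z.1 < z.1.length ∧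
      z.1.length + leadingOnes z.1 + 2 = z.2.2 := by
    intro z hz
    obtain ⟨v, hv⟩ := Part.dom_iff_mem.1 hz
    obtain ⟨s, hs, -⟩ := (hmem z v).1 hv
    exact hs.1
  obtain ⟨e, he⟩ := hΦ.exists_translation hf fun p q y n hp hq h => by
    have h₁ := hdom _ hp
    have h₂ := hdom _ hq
    have h₃ := leadingOnes_eq_of_prefix h h₁.1
    dsimp only at h₁ h₂
    exact h.eq_of_length (by omega)
  refine ⟨e, fun n k s m v hn hm hlt hmin hv => ?_⟩
  obtain ⟨σ, hσ, rfl⟩ := exists_natOfBits_eq hm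
  obtain ⟨q, hq⟩ : ∃ q, q = List.replicate e true ++ false :: σ := ⟨_, rfl⟩
  have hq₁ : leadingOnes q = e := hq ▸ leadingOnes_replicate_append e σ
  have hq₂ : q.length = e + k + 1 := by simp [hq, hσ]; omega
  have hq₃ : q.drop (e + 1) = σ := by simp [hq, List.drop_append]
  have hk : n - (2 * e + 3) = k := by omega
  obtain ⟨p, hp, ho⟩ := he q 0 n v ((hmem _ v).2 ⟨s, by
    simp only [hq₁, hq₂, hq₃, hk, not_and, not_lt]
    exact ⟨⟨by omega, hlt⟩, fun r hr _ => hmin r hr, hv⟩⟩)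
  exact ⟨p, by omega, ho⟩

/-- At any time, the computable approximation `level` of the first `n - E` bits of `Ω^n` is as good
as the possibly non-computable `Ω^n_t`. -/
theorem POptimal.exists_Omega_mul_le (hΦ : Φ.POptimal) :
    ∃ E, ∀ n k : ℕ, k + E = n → ∀ t,
      Φ.Omega n * 2 ^ k ≤ Φ.level k t n + 2 + 2 ^ n * (Φ.Omega n - Φ.OmegaT n t) := by
  obtain ⟨e, he⟩ := hΦ.exists_fresh_translation
  refine ⟨2 * e + 3, fun n k hn t => ?_⟩
  obtain ⟨s, hs⟩ := exists_lt_level_add_two hΦ.1 k n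
  have hprog : ∀ m ∈ Finset.Ico (Φ.level k t n) (Φ.level k s n), ∃ (r v : ℕ) (q : List Bool),
      m < Φ.level k r n ∧ (∀ r' < r, Φ.level k r' n ≤ m) ∧
        (Φ.fresh (n - 2) r n)[m]? = some v ∧ q.length ≤ n - 2 ∧ Φ.Outputs q 0 n v := by
    intro m hm
    rw [Finset.mem_Ico] at hm
    have hex : ∃ r, m < Φ.level k r n := ⟨s, hm.2⟩
    have hmk : m < 2 ^ k := hm.2.trans_le (level_le_two_pow hΦ.1 k s n)
    have hlen : m < (Φ.fresh (n - 2) (Nat.find hex) n).length :=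
      lt_length_fresh (by omega) (hmk.trans_le (Nat.pow_le_pow_right (by norm_num) (by omega)))
    have hmin : ∀ r < Nat.find hex, Φ.level k r n ≤ m := fun r hr => not_lt.1 (Nat.find_min hex hr)
    have hv := List.getElem?_eq_getElem hlen
    obtain ⟨q, hq, ho⟩ :=
      he n k _ m _ (by omega) hmk (Nat.find_spec hex) hmin hv
    exact ⟨_, _, q, Nat.find_spec hex, hmin, hv, hq, ho⟩
  choose! r v q hr hmin hv hq ho using hprog
  set I := Finset.Ico (Φ.level k t n) (Φ.level k s n) with hI
  have hmem : ∀ m ∈ I, v m < 2 ^ n ∧ v m ∉ Φ.found (n - 2) (r m) n := fun m hm =>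
    mem_fresh.1 (List.mem_of_getElem? (hv m hm))
  have hne : ∀ i ∈ I, ∀ j ∈ I, i < j → v i ≠ v j := fun i hi j hj hij => by
    refine fresh_getElem?_ne ?_ hij (hv i hi) (hv j hj)
    by_contra! hlt
    have := hmin i hi _ hlt
    have := hr j hj
    omega
  have hinj : Set.InjOn q I := by
    intro i hi j hj hij
    have hvij : v i = v j := (ho i hi).unique (hij ▸ ho j hj)
    rcases lt_trichotomy i j with h | h | h
    · exact absurd hvij (hne i hi j hj h)
    · exact h
    · exact absurd hvij.symm (hne j hj i hi h)
  have hlate : ∀ m ∈ I, q m ∉ Φ.producingIn n t := by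
    rintro m hm ⟨w, -, hw⟩
    have hwv : w = v m := Outputs.unique ⟨t, hw⟩ (ho m hm)
    have htr : t ≤ r m := by
      by_contra! hlt
      have h₁ := level_mono (Φ := Φ) k n hlt.le
      have h₂ := hr m hm
      have h₃ := (Finset.mem_Ico.1 hm).1
      dsimp only at h₁
      omega
    exact (hmem m hm).2 (mem_found.2 ⟨q m, hq m hm, hwv ▸ Φ.mono htr hw⟩)
  have hsum := sum_weight_le_Omega_sub_OmegaT hΦ.1 (n := n) (t := t) (F := I.image q)
    (by simpa using fun m hm => ⟨v m, (hmem m hm).1, ho m hm⟩) (by simpa using hlate)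
  rw [Finset.sum_image hinj] at hsum
  have hcard := Finset.card_nsmul_le_sum I (fun m => weight (q m)) ((2 : ℝ) ^ n)⁻¹
    fun m hm => weight_ge_of_length_le ((hq m hm).trans (Nat.sub_le n 2))
  rw [nsmul_eq_mul] at hcard
  have hgrow : (I.card : ℝ) ≤ 2 ^ n * (Φ.Omega n - Φ.OmegaT n t) := by
    have := mul_le_mul_of_nonneg_left (hcard.trans hsum) (by positivity : (0 : ℝ) ≤ 2 ^ n)
    rwa [mul_comm (I.card : ℝ), mul_inv_cancel_left₀ (by positivity)] at this
  have hsub : (Φ.level k s n : ℝ) ≤ Φ.level k t n + I.card := by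
    have : Φ.level k s n ≤ Φ.level k t n + I.card := by
      rw [hI, Nat.card_Ico]
      omega
    exact_mod_cast this
  linarith

/-- The first `k_x` bits of `Ω^n`, up to a bounded error, obtained from the approximation of `Ω^n`
at any time `t` when `x` has a program of nearly minimal length. -/
theorem POptimal.exists_OmegaBits_eq (hΦ : Φ.POptimal) (d : ℕ) :
    ∃ E B, ∀ n k x t : ℕ, k + E = n → x < 2 ^ n → x ∈ Φ.found (Φ.C x 0 n + d) t n →
      ∃ i ≤ B, Φ.OmegaBits n (Φ.mdepth d n x) =
        Φ.level k t n * 2 ^ Φ.mdepth d n x / 2 ^ k + i := by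
  obtain ⟨E, hE⟩ := hΦ.exists_Omega_mul_le
  obtain ⟨c, hc⟩ := hΦ.exists_C_le
  refine ⟨E, 1 + 2 * 2 ^ (c + 1 + E) + 2 * 2 ^ E, fun n k x t hn hx ht => ?_⟩
  set j := Φ.mdepth d n x with hj
  have hjn : j ≤ k + (c + 1 + E) := by
    have := mdepth_le hΦ d hx
    have := hc n x hx
    omega
  have hgap := Omega_sub_OmegaT_le_of_mem_found hΦ ht
  rw [← hj] at hgap
  have hup := hE n k hn t
  have hlow := level_le hΦ.1 k t n
  set M := Φ.level k t n
  set G := M * 2 ^ j / 2 ^ k with hG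
  have hGle : (G : ℝ) ≤ Φ.Omega n * 2 ^ j := by
    have h₁ : (G : ℝ) ≤ M * 2 ^ j / 2 ^ k := by
      have := Nat.cast_div_le (α := ℝ) (m := M * 2 ^ j) (n := 2 ^ k)
      push_cast at this
      exact this
    refine h₁.trans ((div_le_iff₀ (by positivity)).2 ?_)
    nlinarith [mul_le_mul_of_nonneg_right hlow (by positivity : (0 : ℝ) ≤ 2 ^ j)]
  have hGlt : (M : ℝ) * 2 ^ j < (G + 1) * 2 ^ k := by
    have := Nat.lt_mul_div_succ (M * 2 ^ j) (show 0 < 2 ^ k by positivity)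
    rw [← hG, mul_comm (2 ^ k)] at this
    exact_mod_cast this
  have hlt : Φ.Omega n * 2 ^ j < G + 1 + 2 * 2 ^ (c + 1 + E) + 2 * 2 ^ E := by
    have hgap' : (2 : ℝ) ^ n * (Φ.Omega n - Φ.OmegaT n t) * 2 ^ j ≤ 2 * 2 ^ n := by
      have := mul_le_mul_of_nonneg_right hgap (by positivity : (0 : ℝ) ≤ 2 ^ n * 2 ^ j)
      rw [mul_comm ((2 : ℝ) ^ n) (2 ^ j), mul_assoc 2, inv_mul_cancel_left₀ (by positivity)] at this
      linarith
    have hpow : (2 : ℝ) ^ n = 2 ^ E * 2 ^ k := by rw [← hn, pow_add, mul_comm]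
    have hj' : (2 : ℝ) ^ j ≤ 2 ^ (c + 1 + E) * 2 ^ k := by
      rw [← pow_add]
      exact pow_le_pow_right₀ (by norm_num) (by omega)
    have hup' := mul_le_mul_of_nonneg_right hup (by positivity : (0 : ℝ) ≤ 2 ^ j)
    have hk : (0 : ℝ) < 2 ^ k := by positivity
    rw [hpow] at hgap' hup'
    refine lt_of_mul_lt_mul_right ?_ hk.le
    linarith
  have hle : G ≤ Φ.OmegaBits n j := Nat.le_floor hGle
  refine ⟨Φ.OmegaBits n j - G, ?_, by omega⟩
  have : Φ.OmegaBits n j < G + 1 + 2 * 2 ^ (c + 1 + E) + 2 * 2 ^ E := by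
    rw [OmegaBits, Nat.floor_lt' (by positivity)]
    push_cast
    exact hlt
  omega

theorem exists_computes_of_lt (hT : Φ.Total) (E : ℕ) (u w : ℕ → ℕ → ℕ) :
    ∃ c, ∀ n < E, ∀ x < 2 ^ n, Φ.Computes c (u n x) n (w n x) := by
  choose p hp using fun n x => hT (w n x) (u n x) n
  refine ⟨(Finset.range E).sup fun n => (Finset.range (2 ^ n)).sup fun x => (p n x).length,
    fun n hn x hx => ⟨p n x, ?_, hp n x⟩⟩
  exact (Finset.le_sup (f := fun x => (p n x).length) (Finset.mem_range.2 hx)).trans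
    (Finset.le_sup (f := fun n => (Finset.range (2 ^ n)).sup fun x => (p n x).length)
      (Finset.mem_range.2 hn))

/-- Given `x, K, j` and an advice `i ≤ B`, wait until `x` has a program of length `K + d`, and output
the first `j` bits of the current approximation of the first `n - E` bits of `Ω^n`, plus `i`. -/
theorem POptimal.exists_computes_level_add (hΦ : Φ.POptimal) (d E : ℕ) :
    ∃ e, ∀ n x j B v : ℕ,
      (∀ t, x ∈ Φ.found (Φ.C x 0 n + d) t n →
        ∃ i ≤ B, v = Φ.level (n - E) t n * 2 ^ j / 2 ^ (n - E) + i) →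
      Φ.Computes (B + 1 + e) (Nat.pair x (Nat.pair (Φ.C x 0 n) j)) n v := by
  have hlead : Primrec fun w : (List Bool × ℕ × ℕ) × ℕ => leadingOnes w.1.1 :=
    primrec_leadingOnes.comp (Primrec.fst.comp Primrec.fst)
  have hn : Primrec fun w : (List Bool × ℕ × ℕ) × ℕ => w.1.2.2 :=
    Primrec.snd.comp (Primrec.snd.comp Primrec.fst)
  have hu : Primrec fun w : (List Bool × ℕ × ℕ) × ℕ => w.1.2.1.unpair :=
    Primrec.unpair.comp (Primrec.fst.comp (Primrec.snd.comp Primrec.fst))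
  have hu' : Primrec fun w : (List Bool × ℕ × ℕ) × ℕ => w.1.2.1.unpair.2.unpair :=
    Primrec.unpair.comp (Primrec.snd.comp hu)
  have hk : Primrec fun w : (List Bool × ℕ × ℕ) × ℕ => w.1.2.2 - E :=
    Primrec.nat_sub.comp hn (Primrec.const E)
  have hlen : Primrec fun w : (List Bool × ℕ × ℕ) × ℕ => w.1.2.1.unpair.2.unpair.1 + d :=
    Primrec.nat_add.comp (Primrec.fst.comp hu') (Primrec.const d)
  have hfound : Computable fun w : (List Bool × ℕ × ℕ) × ℕ =>
      Φ.found (w.1.2.1.unpair.2.unpair.1 + d) w.2 w.1.2.2 :=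
    Φ.computable_found_comp hlen.to_comp Computable.snd hn.to_comp
  have hlevel : Computable fun w : (List Bool × ℕ × ℕ) × ℕ =>
      Φ.level (w.1.2.2 - E) w.2 w.1.2.2 :=
    Φ.computable_level_comp hk.to_comp Computable.snd hn.to_comp
  have hpow : Primrec fun w : (List Bool × ℕ × ℕ) × ℕ => 2 ^ w.1.2.1.unpair.2.unpair.2 :=
    Primrec.nat_pow.comp (Primrec.const 2) (Primrec.snd.comp hu')
  have hpow' : Primrec fun w : (List Bool × ℕ × ℕ) × ℕ => 2 ^ (w.1.2.2 - E) :=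
    Primrec.nat_pow.comp (Primrec.const 2) hk
  have h₁ : PrimrecPred fun w : (List Bool × ℕ × ℕ) × ℕ =>
      leadingOnes w.1.1 + 1 = w.1.1.length :=
    Primrec.eq.comp (Primrec.succ.comp hlead)
      (Primrec.list_length.comp (Primrec.fst.comp Primrec.fst))
  have h₂ : Computable fun w : (List Bool × ℕ × ℕ) × ℕ => decide (¬ w.1.2.1.unpair.1 ∉
      Φ.found (w.1.2.1.unpair.2.unpair.1 + d) w.2 w.1.2.2) :=
    (PrimrecRel.not primrecRel_notMem).decide.to_comp.comp (Primrec.fst.comp hu).to_comp hfound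
  have hnum : Computable fun w : (List Bool × ℕ × ℕ) × ℕ =>
      Φ.level (w.1.2.2 - E) w.2 w.1.2.2 * 2 ^ w.1.2.1.unpair.2.unpair.2 :=
    Primrec.nat_mul.to_comp.comp hlevel hpow.to_comp
  have hdiv : Computable fun w : (List Bool × ℕ × ℕ) × ℕ =>
      Φ.level (w.1.2.2 - E) w.2 w.1.2.2 * 2 ^ w.1.2.1.unpair.2.unpair.2 / 2 ^ (w.1.2.2 - E) :=
    Primrec.nat_div.to_comp.comp hnum hpow'.to_comp
  have hvalue : Computable fun w : (List Bool × ℕ × ℕ) × ℕ =>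
      Φ.level (w.1.2.2 - E) w.2 w.1.2.2 * 2 ^ w.1.2.1.unpair.2.unpair.2 / 2 ^ (w.1.2.2 - E) +
        leadingOnes w.1.1 :=
    Primrec.nat_add.to_comp.comp hdiv hlead.to_comp
  obtain ⟨f, hf, hmem⟩ := exists_partrec_at_first
    (P := fun (z : List Bool × ℕ × ℕ) t => leadingOnes z.1 + 1 = z.1.length ∧
      ¬ z.2.1.unpair.1 ∉ Φ.found (z.2.1.unpair.2.unpair.1 + d) t z.2.2)
    (g := fun z t => some (Φ.level (z.2.2 - E) t z.2.2 * 2 ^ z.2.1.unpair.2.unpair.2 /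
      2 ^ (z.2.2 - E) + leadingOnes z.1))
    (computable_decide_and h₁ h₂) (Computable.option_some.comp hvalue)
  have hdom : ∀ z, (f z).Dom → leadingOnes z.1 + 1 = z.1.length := by
    intro z hz
    obtain ⟨v, hv⟩ := Part.dom_iff_mem.1 hz
    obtain ⟨t, ht, -⟩ := (hmem z v).1 hv
    exact ht.1
  obtain ⟨e, he⟩ := hΦ.exists_translation hf fun p q y n hp hq h => by
    have h₁ := hdom _ hp
    have h₂ := hdom _ hq
    dsimp only at h₁ h₂
    have h₃ := leadingOnes_eq_of_prefix h (by omega)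
    exact h.eq_of_length (by omega)
  refine ⟨e, fun n x j B v hv => ?_⟩
  have hex : ∃ t, x ∈ Φ.found (Φ.C x 0 n + d) t n := by
    obtain ⟨p, hp, t, ht⟩ := exists_outputs_C hΦ.2.1 x 0 n
    exact ⟨t, mem_found.2 ⟨p, by omega, ht⟩⟩
  obtain ⟨i, hi, hvi⟩ := hv _ (Nat.find_spec hex)
  obtain ⟨q, hq⟩ : ∃ q, q = List.replicate i true ++ [false] := ⟨_, rfl⟩
  have hq₁ : leadingOnes q = i := hq ▸ leadingOnes_replicate_append i []
  have hq₂ : q.length = i + 1 := by simp [hq]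
  obtain ⟨q', hq', ho⟩ := he q (Nat.pair x (Nat.pair (Φ.C x 0 n) j)) n v
    ((hmem _ v).2 ⟨Nat.find hex, by
      simp only [hq₁, hq₂, Nat.unpair_pair, not_not]
      exact ⟨⟨trivial, Nat.find_spec hex⟩, fun r hr h => Nat.find_min hex hr h.2, by rw [hvi]⟩⟩)
  exact ⟨q', by omega, ho⟩

end Machine

/-- for every `x ∈ 2^n`: `x, K(x), k_x → Ω^{n,k_x}`. -/
theorem stmt_2 (Φ : Machine) (hΦ : Φ.POptimal) (d : ℕ) :
    ∃ c : ℕ, ∀ n : ℕ, ∀ x < 2 ^ n,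
      Φ.Computes c (Nat.pair x (Nat.pair (Φ.C x 0 n) (Φ.mdepth d n x))) n
        (Φ.OmegaBits n (Φ.mdepth d n x)) := by
  obtain ⟨E, B, hB⟩ := hΦ.exists_OmegaBits_eq d
  obtain ⟨e, he⟩ := hΦ.exists_computes_level_add d E
  obtain ⟨c₀, hc₀⟩ := Machine.exists_computes_of_lt hΦ.2.1 E
    (fun n x => Nat.pair x (Nat.pair (Φ.C x 0 n) (Φ.mdepth d n x)))
    (fun n x => Φ.OmegaBits n (Φ.mdepth d n x))
  refine ⟨max c₀ (B + 1 + e), fun n x hx => ?_⟩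
  rcases lt_or_ge n E with hn | hn
  · obtain ⟨q, hq, ho⟩ := hc₀ n hn x hx
    exact ⟨q, hq.trans (le_max_left ..), ho⟩
  · obtain ⟨q, hq, ho⟩ := he n x (Φ.mdepth d n x) B _
      fun t ht => hB n (n - E) x t (Nat.sub_add_cancel hn) hx ht
    exact ⟨q, hq.trans (le_max_right ..), ho⟩
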